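/- For every α, λ > 0, the elastic Brownian crossing probability ψ^el_α satisfies the fractional differential equation (d/dt)ψ^el_α(t) + ((α + λ)/√2) · (D^{1/2} ψ^el_α)(t) = (α λ/2)(1 − ψ^el_α(t)) − λ/√(2π t) for all t > 0, with initial condition ψ^el_α(0) = 1. -/

import Mathlib

open Real MeasureTheory Set

/-- Mittag-Leffler function `E_{a,b}(z) = Σ z^r / Γ(a r + b)`. -/
noncomputable def mittagLeffler (a b z : ℝ) : ℝ :=
  ∑' r : ℕ, z ^ r / Real.Gamma (a * r + b)

/-- Wright function `W_{a,b}(x) = Σ x^j / (j! Γ(a j + b))`. -/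
noncomputable def wright (a b x : ℝ) : ℝ :=
  ∑' j : ℕ, x ^ j / ((Nat.factorial j : ℝ) * Real.Gamma (a * j + b))

/-- Generalized Mittag-Leffler function `E^γ_{a,b}(z) = Σ (γ)_j z^j / (j! Γ(a j + b))`. -/
noncomputable def gml (a b γ z : ℝ) : ℝ :=
  ∑' j : ℕ, (∏ i ∈ Finset.range j, (γ + i)) * z ^ j /
    ((Nat.factorial j : ℝ) * Real.Gamma (a * j + b))

/-- Caputo fractional derivative of order `ν`. -/
noncomputable def caputo (ν : ℝ) (f : ℝ → ℝ) (t : ℝ) : ℝ :=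
  (1 / Real.Gamma (1 - ν)) * ∫ s in (0:ℝ)..t, (t - s) ^ (-ν) * deriv f s
/-- Crossing probability of an exponential boundary of rate `lam` by the elastic
Brownian motion with absorbing rate `α`. -/
noncomputable def psiEl (α lam t : ℝ) : ℝ :=
  2 * (∫ s in Set.Ioi (0:ℝ), Real.exp (-(lam - α) * s) *
      ∫ w in Set.Ioi s, w * Real.exp (-α * w) * Real.exp (-(w ^ 2) / (2 * t)) /
        Real.sqrt (2 * Real.pi * t ^ 3)) +
    1 - 2 * Real.exp (α ^ 2 * t / 2) *
      ∫ w in Set.Ioi (α * Real.sqrt t), Real.exp (-(w ^ 2) / 2) / Real.sqrt (2 * Real.pi)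

theorem hasDerivAt_arcsin_chord {v t s : ℝ} (h1 : v < s) (h2 : s < t) :
    HasDerivAt (fun s => arcsin ((2 * s - v - t) / (t - v))) ((√(t - s))⁻¹ * (√(s - v))⁻¹) s := by
  have htv : 0 < t - v := by linarith
  have hp : 0 < t - s := by linarith
  have hq : 0 < s - v := by linarith
  have hlt : (2 * s - v - t) / (t - v) < 1 := by rw [div_lt_one htv]; linarith
  have hgt : -1 < (2 * s - v - t) / (t - v) := by rw [lt_div_iff₀ htv]; linarith
  have hin : HasDerivAt (fun s => (2 * s - v - t) / (t - v)) (2 / (t - v)) s := by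
    simpa using ((((hasDerivAt_id s).const_mul 2).sub_const v).sub_const t).div_const (t - v)
  have hsq : √(1 - ((2 * s - v - t) / (t - v)) ^ 2) = 2 * (√(t - s) * √(s - v)) / (t - v) := by
    rw [Real.sqrt_eq_iff_mul_self_eq_of_pos (by positivity)]
    have e1 := Real.mul_self_sqrt hp.le
    have e2 := Real.mul_self_sqrt hq.le
    field_simp
    linear_combination 4 * √(s - v) ^ 2 * e1 + 4 * (t - s) * e2
  refine ((Real.hasDerivAt_arcsin hgt.ne' hlt.ne).comp s hin).congr_deriv ?_
  rw [hsq]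
  have := Real.sqrt_pos.2 hp
  have := Real.sqrt_pos.2 hq
  field_simp

theorem continuous_arcsin_chord (v t : ℝ) :
    Continuous (fun s => arcsin ((2 * s - v - t) / (t - v))) :=
  Real.continuous_arcsin.comp (by fun_prop)

theorem intervalIntegrable_inv_sqrt_mul_inv_sqrt {v t : ℝ} (h : v < t) :
    IntervalIntegrable (fun s => (√(t - s))⁻¹ * (√(s - v))⁻¹) volume v t := by
  rw [intervalIntegrable_iff_integrableOn_Ioc_of_le h.le]
  exact intervalIntegral.integrableOn_deriv_of_nonneg (continuous_arcsin_chord v t).continuousOn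
    (fun s hs => hasDerivAt_arcsin_chord hs.1 hs.2) (fun s _ => by positivity)

theorem integral_inv_sqrt_mul_inv_sqrt {v t : ℝ} (h : v < t) :
    ∫ s in v..t, (√(t - s))⁻¹ * (√(s - v))⁻¹ = π := by
  have htv : t - v ≠ 0 := by linarith
  rw [intervalIntegral.integral_eq_sub_of_hasDerivAt_of_le h.le
    (continuous_arcsin_chord v t).continuousOn
    (fun s hs => hasDerivAt_arcsin_chord hs.1 hs.2) (intervalIntegrable_inv_sqrt_mul_inv_sqrt h)]
  have e1 : (2 * t - v - t) / (t - v) = 1 := by field_simp; ring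
  have e2 : (2 * v - v - t) / (t - v) = -1 := by field_simp; ring
  rw [e1, e2, arcsin_one, arcsin_neg_one]
  ring

theorem intervalIntegrable_inv_sqrt (a b : ℝ) :
    IntervalIntegrable (fun s => (√s)⁻¹) volume a b := by
  have key : ∀ c, 0 ≤ c → IntervalIntegrable (fun s : ℝ => (√s)⁻¹) volume 0 c := fun c hc => by
    refine (intervalIntegral.intervalIntegrable_rpow' (a := 0) (b := c)
      (show (-1 : ℝ) < -(1 / 2) by norm_num)).congr_ae ?_
    rw [uIoc_of_le hc]
    refine (ae_restrict_iff' measurableSet_Ioc).2 (ae_of_all _ fun x hx => ?_)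
    simp only [rpow_neg hx.1.le, sqrt_eq_rpow]
  have key2 : ∀ c, IntervalIntegrable (fun s : ℝ => (√s)⁻¹) volume 0 c := fun c => by
    rcases le_total 0 c with hc | hc
    · exact key c hc
    · refine (intervalIntegrable_const (c := (0 : ℝ))).congr_ae ?_
      rw [uIoc_of_ge hc]
      refine (ae_restrict_iff' measurableSet_Ioc).2 (ae_of_all _ fun x hx => ?_)
      simp [sqrt_eq_zero_of_nonpos hx.2]
  exact (key2 a).symm.trans (key2 b)

theorem intervalIntegrable_inv_sqrt_sub (t a b : ℝ) :
    IntervalIntegrable (fun s => (√(t - s))⁻¹) volume a b := by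
  simpa using (intervalIntegrable_inv_sqrt (t - a) (t - b)).comp_sub_left t

theorem integral_sqrt_mul_inv_sqrt {t : ℝ} (h : 0 < t) :
    IntervalIntegrable (fun s => √(t - s) * (√s)⁻¹) volume 0 t ∧
    ∫ s in (0 : ℝ)..t, √(t - s) * (√s)⁻¹ = π * t / 2 := by
  have hi : IntervalIntegrable (fun s => √(t - s) * (√s)⁻¹) volume 0 t :=
    (intervalIntegrable_inv_sqrt 0 t).continuousOn_mul (by fun_prop)
  refine ⟨hi, ?_⟩
  rw [intervalIntegral.integral_eq_sub_of_hasDerivAt_of_le h.le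
    (f := fun s => √(t - s) * √s + t / 2 * arcsin ((2 * s - 0 - t) / (t - 0))) _ _ hi]
  · have e1 : (2 * t - 0 - t) / (t - 0) = 1 := by rw [div_eq_iff (by linarith)]; ring
    have e2 : (2 * 0 - 0 - t) / (t - 0) = -1 := by rw [div_eq_iff (by linarith)]; ring
    simp only [e1, e2, arcsin_one, arcsin_neg_one]
    simp
    ring
  · exact Continuous.continuousOn
      (((by fun_prop : Continuous fun s => √(t - s) * √s)).add
        (continuous_const.mul (continuous_arcsin_chord 0 t)))
  · intro s hs
    have hp : 0 < t - s := by linarith [hs.2]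
    have hq : 0 < s := hs.1
    have d1 : HasDerivAt (fun s => √(t - s)) (-1 / (2 * √(t - s))) s :=
      ((hasDerivAt_id s).const_sub t).sqrt hp.ne'
    have d2 : HasDerivAt (fun s => √s) (1 / (2 * √s)) s := (hasDerivAt_id s).sqrt hq.ne'
    refine ((d1.mul d2).add
      ((hasDerivAt_arcsin_chord (v := 0) hs.1 hs.2).const_mul (t / 2))).congr_deriv ?_
    have e1 := Real.sq_sqrt hp.le
    have e2 := Real.sq_sqrt hq.le
    have := Real.sqrt_pos.2 hp
    have := Real.sqrt_pos.2 hq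
    simp only [sub_zero]
    field_simp
    linear_combination -e1 - e2

theorem integral_inv_sqrt_mul_sqrt {t : ℝ} (h : 0 < t) :
    ∫ s in (0 : ℝ)..t, (√(t - s))⁻¹ * √s = π * t / 2 := by
  have := intervalIntegral.integral_comp_sub_left (fun s => (√(t - s))⁻¹ * √s) t (a := 0) (b := t)
  simp only [sub_sub_cancel, sub_self, sub_zero] at this
  rw [← this, ← (integral_sqrt_mul_inv_sqrt h).2]
  simp only [mul_comm]

theorem integral_abel_exp (k t : ℝ) (ht : 0 < t) :
    ∫ s in (0 : ℝ)..t, (√(t - s))⁻¹ * ∫ v in (0 : ℝ)..s, exp (k * v) * (√(s - v))⁻¹ =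
      π * ∫ v in (0 : ℝ)..t, exp (k * v) := by
  set h : ℝ → ℝ → ℝ := fun v s => exp (k * v) *
    (Ioc v t).indicator (fun s => (√(t - s))⁻¹ * (√(s - v))⁻¹) s with hh
  have hmeas : Measurable (Function.uncurry h) := by
    have : Function.uncurry h = {p : ℝ × ℝ | p.1 < p.2 ∧ p.2 ≤ t}.indicator
        (fun p => exp (k * p.1) * ((√(t - p.2))⁻¹ * (√(p.2 - p.1))⁻¹)) := by
      ext ⟨v, s⟩
      simp [hh, indicator, Function.uncurry]
    rw [this]
    refine Measurable.indicator (by fun_prop) ?_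
    exact (measurableSet_lt measurable_fst measurable_snd).inter
      (measurableSet_le measurable_snd measurable_const)
  have hinner : ∀ v ∈ Ioo 0 t, IntegrableOn (h v) (Ioc 0 t) ∧ ∫ s in Ioc 0 t, h v s = exp (k * v) * π := by
    intro v hv
    have hI := intervalIntegrable_inv_sqrt_mul_inv_sqrt hv.2
    rw [intervalIntegrable_iff_integrableOn_Ioc_of_le hv.2.le] at hI
    have hs : Ioc 0 t ∩ Ioc v t = Ioc v t := inter_eq_right.2 (Ioc_subset_Ioc_left hv.1.le)
    constructor
    · exact ((integrable_indicator_iff measurableSet_Ioc).2 hI).integrableOn.const_mul _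
    · rw [integral_const_mul, setIntegral_indicator measurableSet_Ioc, hs,
        ← intervalIntegral.integral_of_le hv.2.le, integral_inv_sqrt_mul_inv_sqrt hv.2]
  have hae : ∀ᵐ v ∂volume.restrict (Ioc 0 t), v ∈ Ioo 0 t := by
    rw [← restrict_Ioo_eq_restrict_Ioc]
    exact ae_restrict_mem measurableSet_Ioo
  have hnn : ∀ v s, ‖h v s‖ = h v s := fun v s => by
    rw [Real.norm_eq_abs, abs_of_nonneg]
    exact mul_nonneg (exp_pos _).le (indicator_nonneg (fun _ _ => by positivity) _)
  have hint : Integrable (Function.uncurry h)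
      ((volume.restrict (Ioc 0 t)).prod (volume.restrict (Ioc 0 t))) := by
    rw [integrable_prod_iff hmeas.aestronglyMeasurable]
    constructor
    · filter_upwards [hae] with v hv using (hinner v hv).1
    · have : IntegrableOn (fun v => exp (k * v) * π) (Ioc 0 t) :=
        (by fun_prop : Continuous fun v => exp (k * v) * π).integrableOn_Ioc
      refine this.congr ?_
      filter_upwards [hae] with v hv
      simp only [Function.uncurry, hnn]
      exact (hinner v hv).2.symm
  have hswap := integral_integral_swap hint
  rw [intervalIntegral.integral_of_le ht.le, intervalIntegral.integral_of_le ht.le,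
    ← integral_const_mul]
  calc _ = ∫ s in Ioc 0 t, ∫ v in Ioc 0 t, h v s := by
        refine setIntegral_congr_fun measurableSet_Ioc fun s hs => ?_
        rw [intervalIntegral.integral_of_le hs.1.le, ← integral_const_mul]
        have : ∀ v, h v s = (Iio s).indicator
            (fun v => (√(t - s))⁻¹ * (exp (k * v) * (√(s - v))⁻¹)) v := by
          intro v
          simp only [hh, indicator, mem_Ioc, mem_Iio, hs.2, and_true]
          split_ifs
          · ring
          · simp
        simp_rw [this]
        rw [setIntegral_indicator measurableSet_Iio]
        have : Ioc 0 t ∩ Iio s = Ioo 0 s := by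
          ext v; simp only [mem_inter_iff, mem_Ioc, mem_Iio, mem_Ioo]
          constructor
          · rintro ⟨⟨a, b⟩, c⟩; exact ⟨a, c⟩
          · rintro ⟨a, b⟩; exact ⟨⟨a, by linarith [hs.2]⟩, b⟩
        rw [this, integral_Ioc_eq_integral_Ioo]
    _ = ∫ v in Ioc 0 t, ∫ s in Ioc 0 t, h v s := hswap.symm
    _ = _ := by
        refine integral_congr_ae ?_
        filter_upwards [hae] with v hv
        rw [(hinner v hv).2, mul_comm]

/-- `F` solves the initial value problem characterising `t ↦ exp (a² t) erfc (a √t)`. -/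
structure IsErfcx (a : ℝ) (F : ℝ → ℝ) : Prop where
  continuousOn : ContinuousOn F (Ici 0)
  zero : F 0 = 1
  hasDerivAt : ∀ t > 0, HasDerivAt F (a ^ 2 * F t - a / √π * (√t)⁻¹) t

theorem intervalIntegrable_inv_sqrt_sub_mul {f : ℝ → ℝ} (hf : ContinuousOn f (Ici 0)) {t : ℝ}
    (ht : 0 ≤ t) : IntervalIntegrable (fun s => (√(t - s))⁻¹ * f s) volume 0 t :=
  (intervalIntegrable_inv_sqrt_sub t 0 t).mul_continuousOn
    (hf.mono (by rw [uIcc_of_le ht]; exact Icc_subset_Ici_self))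

namespace IsErfcx

variable {a : ℝ} {F : ℝ → ℝ}

theorem integral_exp_mul_inv_sqrt (hF : IsErfcx a F) (ha : 0 < a) {t : ℝ} (ht : 0 ≤ t) :
    ∫ v in (0 : ℝ)..t, exp (a ^ 2 * v) * (√(t - v))⁻¹ = √π / a * (exp (a ^ 2 * t) - F t) := by
  have hpi : 0 < √π := Real.sqrt_pos.2 pi_pos
  have hint : IntervalIntegrable (fun s => -(a / √π) * (exp (-(a ^ 2 * s)) * (√s)⁻¹)) volume 0 t :=
    ((intervalIntegrable_inv_sqrt 0 t).continuousOn_mul (by fun_prop)).const_mul _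
  have h1 := intervalIntegral.integral_eq_sub_of_hasDerivAt_of_le ht
    (f := fun s => exp (-(a ^ 2 * s)) * F s)
    (f' := fun s => -(a / √π) * (exp (-(a ^ 2 * s)) * (√s)⁻¹))
    (ContinuousOn.mul (by fun_prop) (hF.continuousOn.mono Icc_subset_Ici_self))
    (fun s hs => by
      have d1 : HasDerivAt (fun s => exp (-(a ^ 2 * s))) (exp (-(a ^ 2 * s)) * -(a ^ 2)) s := by
        simpa using (((hasDerivAt_id s).const_mul (a ^ 2)).neg).exp
      exact (d1.mul (hF.hasDerivAt s hs.1)).congr_deriv (by ring)) hint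
  rw [intervalIntegral.integral_const_mul] at h1
  simp only [mul_zero, neg_zero, exp_zero, hF.zero, one_mul] at h1
  have h2 := intervalIntegral.integral_comp_sub_left
    (fun v => exp (a ^ 2 * v) * (√(t - v))⁻¹) t (a := 0) (b := t)
  simp only [sub_sub_cancel, sub_self, sub_zero] at h2
  have h3 : ∀ s, exp (a ^ 2 * (t - s)) * (√s)⁻¹ =
      exp (a ^ 2 * t) * (exp (-(a ^ 2 * s)) * (√s)⁻¹) := fun s => by
    rw [← mul_assoc, ← exp_add]; ring_nf
  simp_rw [h3] at h2
  rw [intervalIntegral.integral_const_mul] at h2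
  rw [← h2]
  have h4 : exp (a ^ 2 * t) * exp (-(a ^ 2 * t)) = 1 := by rw [← exp_add]; simp
  have h5 : ∫ s in (0 : ℝ)..t, exp (-(a ^ 2 * s)) * (√s)⁻¹ =
      √π / a * (1 - exp (-(a ^ 2 * t)) * F t) := by
    field_simp
    field_simp at h1
    linear_combination -h1
  rw [h5]
  linear_combination -(√π / a * F t) * h4

theorem integral_inv_sqrt_mul (hF : IsErfcx a F) (ha : 0 < a) {t : ℝ} (ht : 0 < t) :
    ∫ s in (0 : ℝ)..t, (√(t - s))⁻¹ * F s = √π / a * (1 - F t) := by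
  have hpi : 0 < √π := Real.sqrt_pos.2 pi_pos
  have hrep : ∀ s, 0 ≤ s → a / √π * ∫ v in (0 : ℝ)..s, exp (a ^ 2 * v) * (√(s - v))⁻¹ =
      exp (a ^ 2 * s) - F s := fun s hs => by
    rw [hF.integral_exp_mul_inv_sqrt ha hs]; field_simp
  have hE := intervalIntegrable_inv_sqrt_sub_mul
    (f := fun s => exp (a ^ 2 * s)) (by fun_prop) ht.le
  have hFi := intervalIntegrable_inv_sqrt_sub_mul hF.continuousOn ht.le
  have hA : ∫ s in (0 : ℝ)..t, (√(t - s))⁻¹ * ∫ v in (0 : ℝ)..s, exp (a ^ 2 * v) * (√(s - v))⁻¹ =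
      √π / a * ((∫ s in (0 : ℝ)..t, (√(t - s))⁻¹ * exp (a ^ 2 * s)) -
        ∫ s in (0 : ℝ)..t, (√(t - s))⁻¹ * F s) := by
    rw [← intervalIntegral.integral_sub hE hFi, ← intervalIntegral.integral_const_mul]
    refine intervalIntegral.integral_congr fun s hs => ?_
    rw [uIcc_of_le ht.le] at hs
    rw [hF.integral_exp_mul_inv_sqrt ha hs.1]
    ring
  have hB := hF.integral_exp_mul_inv_sqrt ha ht.le
  simp only [mul_comm (exp _)] at hB
  have hC : ∫ v in (0 : ℝ)..t, exp (a ^ 2 * v) = (exp (a ^ 2 * t) - 1) / a ^ 2 := by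
    rw [intervalIntegral.integral_comp_mul_left (fun x => exp x) (by positivity)]
    simp
    field_simp
  rw [integral_abel_exp _ _ ht, hC, hB] at hA
  have hs : √π * √π = π := Real.mul_self_sqrt pi_pos.le
  have h2 : ∫ s in (0 : ℝ)..t, (√(t - s))⁻¹ * F s =
      √π / a * (exp (a ^ 2 * t) - F t) -
        a / √π * (√π * √π * ((exp (a ^ 2 * t) - 1) / a ^ 2)) := by
    rw [hs, hA]; field_simp; ring
  rw [h2]
  field_simp
  ring

theorem integral_sqrt_mul (hF : IsErfcx a F) (ha : 0 < a) {t : ℝ} (ht : 0 < t) :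
    a ^ 2 * ∫ s in (0 : ℝ)..t, √(t - s) * F s =
      √π / (2 * a) * (1 - F t) + a * √π * t / 2 - √t := by
  have hpi : 0 < √π := Real.sqrt_pos.2 pi_pos
  have i1 := (intervalIntegrable_inv_sqrt_sub_mul hF.continuousOn ht.le).const_mul (-(1 / 2))
  have i2 : IntervalIntegrable (fun s => a ^ 2 * (√(t - s) * F s)) volume 0 t := by
    refine (ContinuousOn.intervalIntegrable ?_).const_mul _
    refine ContinuousOn.mul (by fun_prop) (hF.continuousOn.mono ?_)
    rw [uIcc_of_le ht.le]; exact Icc_subset_Ici_self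
  have i3 := (integral_sqrt_mul_inv_sqrt ht).1.const_mul (-(a / √π))
  have h1 := intervalIntegral.integral_eq_sub_of_hasDerivAt_of_le ht.le
    (f := fun s => √(t - s) * F s)
    (f' := fun s => -(1 / 2) * ((√(t - s))⁻¹ * F s) + a ^ 2 * (√(t - s) * F s) +
      -(a / √π) * (√(t - s) * (√s)⁻¹))
    (ContinuousOn.mul (by fun_prop) (hF.continuousOn.mono Icc_subset_Ici_self))
    (fun s hs => by
      have hp : 0 < t - s := by linarith [hs.2]
      have d1 : HasDerivAt (fun s => √(t - s)) (-1 / (2 * √(t - s))) s :=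
        ((hasDerivAt_id s).const_sub t).sqrt hp.ne'
      refine (d1.mul (hF.hasDerivAt s hs.1)).congr_deriv ?_
      have := Real.sqrt_pos.2 hp
      field_simp
      ring)
    ((i1.add i2).add i3)
  rw [intervalIntegral.integral_add (i1.add i2) i3, intervalIntegral.integral_add i1 i2,
    intervalIntegral.integral_const_mul, intervalIntegral.integral_const_mul,
    intervalIntegral.integral_const_mul, (integral_sqrt_mul_inv_sqrt ht).2,
    hF.integral_inv_sqrt_mul ha ht] at h1
  simp only [sub_self, sqrt_zero, zero_mul, sub_zero, hF.zero, mul_one] at h1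
  have h2 : a / √π * (π * t / 2) = a * √π * t / 2 := by
    linear_combination a * t / 2 * Real.div_sqrt (x := π)
  linear_combination h1 + h2

theorem integral_inv_sqrt_mul_id_mul (hF : IsErfcx a F) (ha : 0 < a) {t : ℝ} (ht : 0 < t) :
    a ^ 2 * ∫ s in (0 : ℝ)..t, (√(t - s))⁻¹ * (s * F s) =
      a * t * √π * (1 - F t) - √π / (2 * a) * (1 - F t) - a * √π * t / 2 + √t := by
  have i1 := (intervalIntegrable_inv_sqrt_sub_mul hF.continuousOn ht.le).const_mul t
  have i2 : IntervalIntegrable (fun s => √(t - s) * F s) volume 0 t := by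
    refine (ContinuousOn.intervalIntegrable ?_)
    refine ContinuousOn.mul (by fun_prop) (hF.continuousOn.mono ?_)
    rw [uIcc_of_le ht.le]; exact Icc_subset_Ici_self
  have h1 : ∫ s in (0 : ℝ)..t, (√(t - s))⁻¹ * (s * F s) =
      t * (∫ s in (0 : ℝ)..t, (√(t - s))⁻¹ * F s) - ∫ s in (0 : ℝ)..t, √(t - s) * F s := by
    rw [← intervalIntegral.integral_const_mul, ← intervalIntegral.integral_sub i1 i2]
    refine intervalIntegral.integral_congr_ae (ae_of_all _ fun s hs => ?_)
    rw [uIoc_of_le ht.le] at hs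
    rcases hs.2.eq_or_lt with rfl | hlt
    · simp
    have hp : 0 < t - s := by linarith
    have e := Real.sq_sqrt hp.le
    have := Real.sqrt_pos.2 hp
    field_simp
    linear_combination (F s) * e
  rw [h1, hF.integral_inv_sqrt_mul ha ht, mul_sub, hF.integral_sqrt_mul ha ht]
  field_simp
  ring

end IsErfcx

theorem caputo_half_eq (f : ℝ → ℝ) {t : ℝ} (ht : 0 ≤ t) :
    caputo (1 / 2) f t = 1 / √π * ∫ s in (0 : ℝ)..t, (√(t - s))⁻¹ * deriv f s := by
  unfold caputo
  rw [show (1 : ℝ) - 1 / 2 = 1 / 2 by norm_num, Real.Gamma_one_half_eq]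
  congr 1
  refine intervalIntegral.integral_congr fun s hs => ?_
  rw [uIcc_of_le ht] at hs
  simp only [rpow_neg (sub_nonneg.2 hs.2), sqrt_eq_rpow]

/-- The formula for `psiEl - 1` in terms of the functions of `IsErfcx`. -/
structure IsCrossing (a b : ℝ) (F G g : ℝ → ℝ) : Prop where
  of_ne : a ≠ b → ∀ t ≥ 0, g t = b / (b - a) * (F t - G t)
  of_eq : a = b → ∀ t ≥ 0, g t = 2 * b ^ 2 * (t * F t) - 2 * b / √π * √t

namespace IsCrossing

variable {a b : ℝ} {F G g : ℝ → ℝ}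

theorem zero (h : IsCrossing a b F G g) (hF : IsErfcx b F) (hG : IsErfcx a G) : g 0 = 0 := by
  by_cases hab : a = b
  · simp [h.of_eq hab 0 le_rfl]
  · simp [h.of_ne hab 0 le_rfl, hF.zero, hG.zero]

theorem continuousOn (h : IsCrossing a b F G g) (hF : IsErfcx b F) (hG : IsErfcx a G) :
    ContinuousOn g (Ici 0) := by
  have := hF.continuousOn
  have := hG.continuousOn
  by_cases hab : a = b
  · refine ContinuousOn.congr ?_ (h.of_eq hab)
    fun_prop
  · refine ContinuousOn.congr ?_ (h.of_ne hab)
    fun_prop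

theorem hasDerivAt (h : IsCrossing a b F G g) (hF : IsErfcx b F) (hG : IsErfcx a G) {t : ℝ}
    (ht : 0 < t) :
    HasDerivAt g (a ^ 2 * g t + b * (a + b) * F t - b / √π * (√t)⁻¹) t := by
  have hpi : 0 < √π := Real.sqrt_pos.2 pi_pos
  have hnhds : Ici (0 : ℝ) ∈ nhds t := Ici_mem_nhds ht
  by_cases hab : a = b
  · have d := (((hasDerivAt_id t).mul (hF.hasDerivAt t ht)).const_mul (2 * b ^ 2)).sub
      (((hasDerivAt_id t).sqrt ht.ne').const_mul (2 * b / √π))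
    refine (d.congr_of_eventuallyEq
      (Filter.eventuallyEq_of_mem hnhds (h.of_eq hab))).congr_deriv ?_
    rw [h.of_eq hab t ht.le, hab]
    have e := Real.sq_sqrt ht.le
    have := Real.sqrt_pos.2 ht
    simp only [id]
    field_simp
    linear_combination (2 * b ^ 3) * e
  · have d := ((hF.hasDerivAt t ht).sub (hG.hasDerivAt t ht)).const_mul (b / (b - a))
    refine (d.congr_of_eventuallyEq
      (Filter.eventuallyEq_of_mem hnhds (h.of_ne hab))).congr_deriv ?_
    rw [h.of_ne hab t ht.le]
    have hba : b - a ≠ 0 := sub_ne_zero.2 (Ne.symm hab)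
    have := Real.sqrt_pos.2 ht
    field_simp
    ring

theorem integral_inv_sqrt_mul (h : IsCrossing a b F G g) (hF : IsErfcx b F) (hG : IsErfcx a G)
    (ha : 0 < a) (hb : 0 < b) {t : ℝ} (ht : 0 < t) :
    ∫ s in (0 : ℝ)..t, (√(t - s))⁻¹ * g s = √π / a * (F t - 1 - g t) := by
  have hpi : 0 < √π := Real.sqrt_pos.2 pi_pos
  by_cases hab : a = b
  · have i1 := (intervalIntegrable_inv_sqrt_sub_mul (f := fun s => s * F s)
      (continuousOn_id.mul hF.continuousOn) ht.le).const_mul (2 * b ^ 2)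
    have i2 := (intervalIntegrable_inv_sqrt_sub_mul (f := fun s => √s)
      (by fun_prop) ht.le).const_mul (2 * b / √π)
    have h1 : ∫ s in (0 : ℝ)..t, (√(t - s))⁻¹ * g s =
        2 * (b ^ 2 * ∫ s in (0 : ℝ)..t, (√(t - s))⁻¹ * (s * F s)) -
          2 * b / √π * ∫ s in (0 : ℝ)..t, (√(t - s))⁻¹ * √s := by
      rw [← mul_assoc, ← intervalIntegral.integral_const_mul,
        ← intervalIntegral.integral_const_mul, ← intervalIntegral.integral_sub i1 i2]
      refine intervalIntegral.integral_congr fun s hs => ?_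
      rw [uIcc_of_le ht.le] at hs
      simp only [h.of_eq hab s hs.1]
      ring
    have h2 : 2 * b / √π * (π * t / 2) = b * √π * t := by
      linear_combination b * t * Real.div_sqrt (x := π)
    rw [h1, hF.integral_inv_sqrt_mul_id_mul hb ht, integral_inv_sqrt_mul_sqrt ht, h2,
      h.of_eq hab t ht.le, hab]
    field_simp
    ring
  · have hba : b - a ≠ 0 := sub_ne_zero.2 (Ne.symm hab)
    have h1 : ∫ s in (0 : ℝ)..t, (√(t - s))⁻¹ * g s =
        b / (b - a) * ((∫ s in (0 : ℝ)..t, (√(t - s))⁻¹ * F s) -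
          ∫ s in (0 : ℝ)..t, (√(t - s))⁻¹ * G s) := by
      rw [← intervalIntegral.integral_sub
        (intervalIntegrable_inv_sqrt_sub_mul hF.continuousOn ht.le)
        (intervalIntegrable_inv_sqrt_sub_mul hG.continuousOn ht.le),
        ← intervalIntegral.integral_const_mul]
      refine intervalIntegral.integral_congr fun s hs => ?_
      rw [uIcc_of_le ht.le] at hs
      simp only [h.of_ne hab s hs.1]
      ring
    rw [h1, hF.integral_inv_sqrt_mul hb ht, hG.integral_inv_sqrt_mul ha ht, h.of_ne hab t ht.le]
    field_simp
    ring

theorem caputo_half (h : IsCrossing a b F G g) (hF : IsErfcx b F) (hG : IsErfcx a G)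
    (ha : 0 < a) (hb : 0 < b) {t : ℝ} (ht : 0 < t) :
    caputo (1 / 2) g t = -(a * g t) - b * F t := by
  have hpi : 0 < √π := Real.sqrt_pos.2 pi_pos
  rw [caputo_half_eq _ ht.le]
  have i1 := (intervalIntegrable_inv_sqrt_sub_mul (h.continuousOn hF hG) ht.le).const_mul (a ^ 2)
  have i2 := (intervalIntegrable_inv_sqrt_sub_mul hF.continuousOn ht.le).const_mul (b * (a + b))
  have i3 : IntervalIntegrable (fun s => (√(t - s))⁻¹ * (√s)⁻¹) volume 0 t := by
    simpa using intervalIntegrable_inv_sqrt_mul_inv_sqrt ht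
  have h3 : ∫ s in (0 : ℝ)..t, (√(t - s))⁻¹ * (√s)⁻¹ = π := by
    simpa using integral_inv_sqrt_mul_inv_sqrt ht
  have h1 : ∫ s in (0 : ℝ)..t, (√(t - s))⁻¹ * deriv g s =
      ∫ s in (0 : ℝ)..t, a ^ 2 * ((√(t - s))⁻¹ * g s) + b * (a + b) * ((√(t - s))⁻¹ * F s) -
        b / √π * ((√(t - s))⁻¹ * (√s)⁻¹) := by
    refine intervalIntegral.integral_congr_ae (ae_of_all _ fun s hs => ?_)
    rw [uIoc_of_le ht.le] at hs
    rw [(h.hasDerivAt hF hG hs.1).deriv]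
    ring
  rw [h1, intervalIntegral.integral_sub (i1.add i2) (i3.const_mul _),
    intervalIntegral.integral_add i1 i2, intervalIntegral.integral_const_mul,
    intervalIntegral.integral_const_mul, intervalIntegral.integral_const_mul, h3,
    h.integral_inv_sqrt_mul hF hG ha hb ht, hF.integral_inv_sqrt_mul hb ht]
  have h2 : b / √π * π = b * √π := by
    linear_combination b * Real.div_sqrt (x := π)
  rw [h2]
  field_simp
  ring

theorem fractional_ode (h : IsCrossing a b F G g) (hF : IsErfcx b F) (hG : IsErfcx a G)
    (ha : 0 < a) (hb : 0 < b) {t : ℝ} (ht : 0 < t) :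
    deriv g t + (a + b) * caputo (1 / 2) g t = -(a * b * g t) - b / √π * (√t)⁻¹ := by
  rw [h.caputo_half hF hG ha hb ht, (h.hasDerivAt hF hG ht).deriv]
  ring

end IsCrossing

/-- The upper tail of the standard normal distribution. -/
noncomputable def gaussianTail (x : ℝ) : ℝ :=
  ∫ w in Ioi x, exp (-(w ^ 2) / 2) / √(2 * π)

theorem integrable_gaussian_density : Integrable fun w : ℝ => exp (-(w ^ 2) / 2) / √(2 * π) := by
  have := (integrable_exp_neg_mul_sq (b := 1 / 2) (by norm_num)).div_const √(2 * π)
  refine this.congr (ae_of_all _ fun w => ?_)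
  ring_nf

theorem gaussianTail_zero : gaussianTail 0 = 1 / 2 := by
  have h := integral_gaussian_Ioi (1 / 2)
  have e : π / (1 / 2) = 2 * π := by ring
  rw [e] at h
  have hp : 0 < √(2 * π) := by positivity
  unfold gaussianTail
  rw [integral_div, show (fun w : ℝ => exp (-(w ^ 2) / 2)) = fun w => exp (-(1 / 2) * w ^ 2) by
    ext w; ring_nf, h]
  field_simp

theorem hasDerivAt_gaussianTail (x : ℝ) :
    HasDerivAt gaussianTail (-(exp (-(x ^ 2) / 2) / √(2 * π))) x := by
  have hc : Continuous fun w : ℝ => exp (-(w ^ 2) / 2) / √(2 * π) := by fun_prop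
  have h : gaussianTail = fun x => gaussianTail 0 -
      ∫ w in (0 : ℝ)..x, exp (-(w ^ 2) / 2) / √(2 * π) := by
    ext x
    unfold gaussianTail
    rw [← intervalIntegral.integral_Ioi_sub_Ioi' integrable_gaussian_density.integrableOn
      integrable_gaussian_density.integrableOn]
    ring
  rw [h]
  exact (hc.integral_hasStrictDerivAt 0 x).hasDerivAt.const_sub _

/-- The function `t ↦ exp (c² t / 2) erfc (c √(t / 2))`. -/
noncomputable def erfcxTime (c t : ℝ) : ℝ := 2 * exp (c ^ 2 * t / 2) * gaussianTail (c * √t)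

theorem isErfcx_erfcxTime (c : ℝ) : IsErfcx (c / √2) (erfcxTime c) where
  continuousOn := by
    have h : Continuous gaussianTail :=
      continuous_iff_continuousAt.2 fun x => (hasDerivAt_gaussianTail x).continuousAt
    unfold erfcxTime
    fun_prop
  zero := by simp [erfcxTime, gaussianTail_zero]
  hasDerivAt t ht := by
    have d1 : HasDerivAt (fun t => 2 * exp (c ^ 2 * t / 2))
        (2 * (exp (c ^ 2 * t / 2) * (c ^ 2 / 2))) t := by
      simpa using ((((hasDerivAt_id t).const_mul (c ^ 2)).div_const 2).exp).const_mul 2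
    have d2 : HasDerivAt (fun t => c * √t) (c * (1 / (2 * √t))) t :=
      ((hasDerivAt_id t).sqrt ht.ne').const_mul c
    refine (d1.mul ((hasDerivAt_gaussianTail (c * √t)).comp t d2)).congr_deriv ?_
    have hsq : (c * √t) ^ 2 = c ^ 2 * t := by rw [mul_pow, Real.sq_sqrt ht.le]
    have he : exp (c ^ 2 * t / 2) * exp (-(c ^ 2 * t / 2)) = 1 := by
      rw [← exp_add, add_neg_cancel, exp_zero]
    have hs2 : √2 ^ 2 = 2 := Real.sq_sqrt (by norm_num)
    have h2pi : √(2 * π) = √2 * √π := Real.sqrt_mul (by norm_num) _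
    have hp : 0 < √π := Real.sqrt_pos.2 pi_pos
    have ht' := Real.sqrt_pos.2 ht
    simp only [Function.comp, erfcxTime, hsq, div_pow, hs2, h2pi]
    field_simp
    linear_combination -c * he

theorem integrable_pow_mul_exp_mul_exp (n : ℕ) (c : ℝ) {t : ℝ} (ht : 0 < t) :
    Integrable fun w : ℝ => w ^ n * (exp (-c * w) * exp (-(w ^ 2) / (2 * t))) := by
  have h0 := (integrable_rpow_mul_exp_neg_mul_sq (b := 1 / (4 * t)) (by positivity)
    (s := n) (by linarith [(Nat.cast_nonneg n : (0 : ℝ) ≤ n)])).norm.const_mul (exp (c ^ 2 * t))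
  refine h0.mono' (by fun_prop) (ae_of_all _ fun w => ?_)
  rw [rpow_natCast]
  simp only [norm_mul]
  rw [mul_left_comm (exp (c ^ 2 * t))]
  refine mul_le_mul_of_nonneg_left ?_ (norm_nonneg (w ^ n))
  simp only [Real.norm_eq_abs, abs_exp]
  rw [← exp_add, ← exp_add, exp_le_exp]
  have : c ^ 2 * t + -(1 / (4 * t)) * w ^ 2 - (-c * w + -(w ^ 2) / (2 * t)) =
      (w + 2 * c * t) ^ 2 / (4 * t) := by
    field_simp; ring
  have : 0 ≤ (w + 2 * c * t) ^ 2 / (4 * t) := by positivity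
  linarith

/-- The truncated moments `∫₀^∞ wⁿ exp (-c w - w² / (2 t)) dw`. -/
noncomputable def tiltedMoment (n : ℕ) (c t : ℝ) : ℝ :=
  ∫ w in Ioi (0 : ℝ), w ^ n * (exp (-c * w) * exp (-(w ^ 2) / (2 * t)))

theorem integral_comp_add_Ioi_zero (f : ℝ → ℝ) (d : ℝ) :
    ∫ x in Ioi (0 : ℝ), f (x + d) = ∫ x in Ioi d, f x := by
  rw [← (measurePreserving_add_right volume d).setIntegral_preimage_emb
    (measurableEmbedding_addRight d) f (Ioi d), preimage_add_const_Ioi, sub_self]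

theorem tiltedMoment_zero (c : ℝ) {t : ℝ} (ht : 0 < t) :
    tiltedMoment 0 c t = √(2 * π) * √t / 2 * erfcxTime c t := by
  have hts := Real.sqrt_pos.2 ht
  have hst := Real.sq_sqrt ht.le
  have h2 : 0 < √(2 * π) := by positivity
  have key : ∀ w, w ^ 0 * (exp (-c * w) * exp (-(w ^ 2) / (2 * t))) =
      (fun x => √(2 * π) * exp (c ^ 2 * t / 2) *
        (exp (-((x + c * √t) ^ 2) / 2) / √(2 * π))) ((√t)⁻¹ * w) := fun w => by
    dsimp only
    rw [pow_zero, one_mul, ← exp_add, mul_assoc, ← mul_div_assoc, mul_div_assoc',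
      mul_div_cancel_left₀ _ h2.ne', ← exp_add]
    congr 1
    have e1 : ((√t)⁻¹ * w + c * √t) ^ 2 = w ^ 2 / t + 2 * c * w + c ^ 2 * t := by
      rw [← hst]; simp only [Real.sqrt_sq hts.le]; field_simp; ring
    rw [e1]
    field_simp
    ring
  unfold tiltedMoment
  simp_rw [key]
  rw [integral_comp_mul_left_Ioi (fun x => √(2 * π) * exp (c ^ 2 * t / 2) *
      (exp (-((x + c * √t) ^ 2) / 2) / √(2 * π))) _ (inv_pos.2 hts), mul_zero, integral_const_mul,
    integral_comp_add_Ioi_zero (fun x => exp (-(x ^ 2) / 2) / √(2 * π)) (c * √t)]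
  simp only [erfcxTime, gaussianTail, inv_inv, smul_eq_mul]
  ring

theorem hasDerivAt_exp_mul_exp (c : ℝ) {t : ℝ} (ht : 0 < t) (w : ℝ) :
    HasDerivAt (fun w => exp (-c * w) * exp (-(w ^ 2) / (2 * t)))
      (-(c + w / t) * (exp (-c * w) * exp (-(w ^ 2) / (2 * t)))) w := by
  have d1 : HasDerivAt (fun w => exp (-c * w)) (exp (-c * w) * -c) w := by
    simpa using ((hasDerivAt_id w).const_mul (-c)).exp
  have d2 : HasDerivAt (fun w => exp (-(w ^ 2) / (2 * t)))
      (exp (-(w ^ 2) / (2 * t)) * (-(2 * w) / (2 * t))) w := by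
    simpa using (((hasDerivAt_pow 2 w).neg).div_const (2 * t)).exp
  refine (d1.mul d2).congr_deriv ?_
  field_simp
  ring

theorem tiltedMoment_one (c : ℝ) {t : ℝ} (ht : 0 < t) :
    tiltedMoment 1 c t = t - c * t * tiltedMoment 0 c t := by
  have i0 := (integrable_pow_mul_exp_mul_exp 0 c ht).integrableOn (s := Ioi 0)
  have i1 := (integrable_pow_mul_exp_mul_exp 1 c ht).integrableOn (s := Ioi 0)
  have hd : ∀ w : ℝ, HasDerivAt (fun w => w ^ 0 * (exp (-c * w) * exp (-(w ^ 2) / (2 * t))))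
      (-c * (w ^ 0 * (exp (-c * w) * exp (-(w ^ 2) / (2 * t)))) -
        1 / t * (w ^ 1 * (exp (-c * w) * exp (-(w ^ 2) / (2 * t))))) w := fun w => by
    simp only [pow_zero, one_mul]
    exact (hasDerivAt_exp_mul_exp c ht w).congr_deriv (by ring)
  have id := (i0.const_mul (-c)).sub (i1.const_mul (1 / t))
  have h := integral_Ioi_of_hasDerivAt_of_tendsto (hd 0).continuousAt.continuousWithinAt
    (fun w _ => hd w) id (tendsto_zero_of_hasDerivAt_of_integrableOn_Ioi (fun w _ => hd w) id i0)
  rw [integral_sub (i0.const_mul (-c)) (i1.const_mul (1 / t)), integral_const_mul,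
    integral_const_mul] at h
  change -c * tiltedMoment 0 c t - 1 / t * tiltedMoment 1 c t = _ at h
  simp at h
  field_simp at h
  linear_combination -h

theorem tiltedMoment_two (c : ℝ) {t : ℝ} (ht : 0 < t) :
    tiltedMoment 2 c t = t * tiltedMoment 0 c t - c * t * tiltedMoment 1 c t := by
  have i0 := (integrable_pow_mul_exp_mul_exp 0 c ht).integrableOn (s := Ioi 0)
  have i1 := (integrable_pow_mul_exp_mul_exp 1 c ht).integrableOn (s := Ioi 0)
  have i2 := (integrable_pow_mul_exp_mul_exp 2 c ht).integrableOn (s := Ioi 0)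
  have hd : ∀ w : ℝ, HasDerivAt (fun w => w ^ 1 * (exp (-c * w) * exp (-(w ^ 2) / (2 * t))))
      (w ^ 0 * (exp (-c * w) * exp (-(w ^ 2) / (2 * t))) -
        c * (w ^ 1 * (exp (-c * w) * exp (-(w ^ 2) / (2 * t)))) -
        1 / t * (w ^ 2 * (exp (-c * w) * exp (-(w ^ 2) / (2 * t))))) w := fun w =>
    ((hasDerivAt_pow 1 w).mul (hasDerivAt_exp_mul_exp c ht w)).congr_deriv (by
      simp only [Nat.cast_one, tsub_self]; ring)
  have i01 : IntegrableOn (fun w : ℝ => w ^ 0 * (exp (-c * w) * exp (-(w ^ 2) / (2 * t))) -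
      c * (w ^ 1 * (exp (-c * w) * exp (-(w ^ 2) / (2 * t))))) (Ioi 0) := i0.sub (i1.const_mul c)
  have id := i01.sub (i2.const_mul (1 / t))
  have h := integral_Ioi_of_hasDerivAt_of_tendsto (hd 0).continuousAt.continuousWithinAt
    (fun w _ => hd w) id (tendsto_zero_of_hasDerivAt_of_integrableOn_Ioi (fun w _ => hd w) id i1)
  rw [integral_sub i01 (i2.const_mul (1 / t)),
    integral_sub i0 (i1.const_mul c), integral_const_mul,
    integral_const_mul] at h
  change tiltedMoment 0 c t - c * tiltedMoment 1 c t - 1 / t * tiltedMoment 2 c t = _ at h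
  simp at h
  field_simp at h
  linear_combination -h

theorem integral_exp_mul_integral_Ioi (α lam : ℝ) {t : ℝ} (ht : 0 < t) :
    ∫ s in Ioi (0 : ℝ), exp (-(lam - α) * s) *
      ∫ w in Ioi s, w * exp (-α * w) * exp (-(w ^ 2) / (2 * t)) / √(2 * π * t ^ 3) =
    (∫ w in Ioi (0 : ℝ), (w * (exp (-α * w) * exp (-(w ^ 2) / (2 * t)))) *
      ∫ s in (0 : ℝ)..w, exp (-(lam - α) * s)) / √(2 * π * t ^ 3) := by
  set d := |lam - α| + 1 with hd
  set p : ℝ → ℝ := fun w => w * (exp (-α * w) * exp (-(w ^ 2) / (2 * t))) with hp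
  set h : ℝ → ℝ → ℝ := fun s w => (Ioi s).indicator (fun w => exp (-(lam - α) * s) * p w) w with hh
  have hpm : Measurable p := by fun_prop
  have hmeas : Measurable (Function.uncurry h) := by
    have : Function.uncurry h = {x : ℝ × ℝ | x.1 < x.2}.indicator
        (fun x => exp (-(lam - α) * x.1) * p x.2) := by
      ext ⟨s, w⟩
      simp [hh, indicator, Function.uncurry]
    rw [this]
    exact Measurable.indicator (by fun_prop) (measurableSet_lt measurable_fst measurable_snd)
  have hint : Integrable (Function.uncurry h)
      ((volume.restrict (Ioi 0)).prod (volume.restrict (Ioi 0))) := by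
    have j1 : IntegrableOn (fun s : ℝ => exp (-s)) (Ioi 0) := integrableOn_exp_neg_Ioi 0
    have j2 := (integrable_pow_mul_exp_mul_exp 1 (α - d) ht).integrableOn (s := Ioi 0)
    refine (Integrable.mul_prod j1 j2).mono' hmeas.aestronglyMeasurable ?_
    rw [Measure.prod_restrict]
    refine (ae_restrict_iff' (measurableSet_Ioi.prod measurableSet_Ioi)).2 (ae_of_all _ ?_)
    rintro ⟨s, w⟩ ⟨hs, hw⟩
    simp only [mem_Ioi] at hs hw
    simp only [Function.uncurry, hh, indicator, mem_Ioi]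
    split_ifs with hsw
    · rw [Real.norm_eq_abs, abs_of_nonneg (by positivity)]
      have e : exp (-(lam - α) * s) ≤ exp (-s) * exp (d * w) := by
        rw [← exp_add, exp_le_exp]
        have h1 : -(lam - α) * s ≤ |lam - α| * w := by
          refine (mul_le_mul_of_nonneg_right (neg_le_abs _) hs.le).trans ?_
          exact mul_le_mul_of_nonneg_left hsw.le (abs_nonneg _)
        rw [hd]; linarith
      have e2 : exp (-(α - d) * w) = exp (d * w) * exp (-α * w) := by
        rw [← exp_add]; ring_nf
      rw [e2, pow_one, hp]
      calc _ ≤ (exp (-s) * exp (d * w)) *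
            (w * (exp (-α * w) * exp (-(w ^ 2) / (2 * t)))) :=
            mul_le_mul_of_nonneg_right e (by positivity)
        _ = _ := by ring
    · rw [norm_zero]; positivity
  have hswap := integral_integral_swap hint
  have hL : ∀ s ∈ Ioi (0 : ℝ), exp (-(lam - α) * s) *
      ∫ w in Ioi s, w * exp (-α * w) * exp (-(w ^ 2) / (2 * t)) / √(2 * π * t ^ 3) =
      (∫ w in Ioi 0, h s w) / √(2 * π * t ^ 3) := fun s hs => by
    rw [integral_div, ← mul_div_assoc, setIntegral_indicator measurableSet_Ioi, Ioi_inter_Ioi,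
      sup_eq_right.2 (mem_Ioi.1 hs).le, integral_const_mul]
    simp only [hp, mul_assoc]
  rw [setIntegral_congr_fun measurableSet_Ioi hL, integral_div, hswap]
  congr 1
  refine setIntegral_congr_fun measurableSet_Ioi fun w hw => ?_
  have hw' : 0 < w := hw
  have e : ∀ s, h s w = (Iio w).indicator (fun s => p w * exp (-(lam - α) * s)) s := fun s => by
    simp only [hh, indicator, mem_Ioi, mem_Iio, mul_comm]
  simp_rw [e]
  rw [setIntegral_indicator measurableSet_Iio, Ioi_inter_Iio, integral_const_mul,
    intervalIntegral.integral_of_le hw'.le, integral_Ioc_eq_integral_Ioo]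

theorem psiEl_eq (α lam : ℝ) {t : ℝ} (ht : 0 < t) :
    psiEl α lam t = 2 * ((∫ w in Ioi (0 : ℝ), (w * (exp (-α * w) * exp (-(w ^ 2) / (2 * t)))) *
      ∫ s in (0 : ℝ)..w, exp (-(lam - α) * s)) / √(2 * π * t ^ 3)) + 1 - erfcxTime α t := by
  unfold psiEl erfcxTime gaussianTail
  rw [integral_exp_mul_integral_Ioi α lam ht]

theorem sqrt_two_pi_mul_cube {t : ℝ} (ht : 0 < t) : √(2 * π * t ^ 3) = √(2 * π) * (t * √t) := by
  rw [Real.sqrt_mul (by positivity : 0 ≤ 2 * π), show t ^ 3 = t ^ 2 * t by ring,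
    Real.sqrt_mul (sq_nonneg t), Real.sqrt_sq ht.le]

theorem psiEl_of_ne {α lam : ℝ} (hne : α ≠ lam) {t : ℝ} (ht : 0 < t) :
    psiEl α lam t = 1 + lam / (lam - α) * (erfcxTime lam t - erfcxTime α t) := by
  have hd : lam - α ≠ 0 := sub_ne_zero.2 hne.symm
  have h1 : ∫ w in Ioi (0 : ℝ), (w * (exp (-α * w) * exp (-(w ^ 2) / (2 * t)))) *
      ∫ s in (0 : ℝ)..w, exp (-(lam - α) * s) =
      (tiltedMoment 1 α t - tiltedMoment 1 lam t) / (lam - α) := by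
    unfold tiltedMoment
    rw [← integral_sub (integrable_pow_mul_exp_mul_exp 1 α ht).integrableOn
      (integrable_pow_mul_exp_mul_exp 1 lam ht).integrableOn, ← integral_div]
    refine setIntegral_congr_fun measurableSet_Ioi fun w _ => ?_
    rw [intervalIntegral.integral_comp_mul_left (fun x => exp x) (neg_ne_zero.2 hd), integral_exp,
      show -lam * w = -α * w + -(lam - α) * w by ring, exp_add]
    simp only [mul_zero, exp_zero, smul_eq_mul]
    field_simp
    ring
  have hts := Real.sqrt_pos.2 ht
  have h2 : 0 < √(2 * π) := by positivity
  rw [psiEl_eq α lam ht, h1, sqrt_two_pi_mul_cube ht, tiltedMoment_one α ht,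
    tiltedMoment_one lam ht, tiltedMoment_zero α ht, tiltedMoment_zero lam ht]
  field_simp
  ring

theorem psiEl_self (c : ℝ) {t : ℝ} (ht : 0 < t) :
    psiEl c c t = 1 + c ^ 2 * (t * erfcxTime c t) - 2 * c / √(2 * π) * √t := by
  have h1 : ∫ w in Ioi (0 : ℝ), (w * (exp (-c * w) * exp (-(w ^ 2) / (2 * t)))) *
      ∫ s in (0 : ℝ)..w, exp (-(c - c) * s) = tiltedMoment 2 c t := by
    unfold tiltedMoment
    refine setIntegral_congr_fun measurableSet_Ioi fun w _ => ?_
    simp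
    ring
  have hts := Real.sqrt_pos.2 ht
  have hst := Real.sq_sqrt ht.le
  have h2 : 0 < √(2 * π) := by positivity
  rw [psiEl_eq c c ht, h1, sqrt_two_pi_mul_cube ht, tiltedMoment_two c ht, tiltedMoment_one c ht,
    tiltedMoment_zero c ht]
  field_simp
  linear_combination (2 * c) * hst

theorem isCrossing_psiEl (α lam : ℝ) :
    IsCrossing (α / √2) (lam / √2) (erfcxTime lam) (erfcxTime α)
      (fun t => if 0 < t then psiEl α lam t - 1 else 0) where
  of_ne hne t ht := by
    have hne' : α ≠ lam := fun h => hne (by rw [h])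
    have hd : lam - α ≠ 0 := sub_ne_zero.2 hne'.symm
    rcases (ge_iff_le.1 ht).eq_or_lt with rfl | hpos
    · simp [(isErfcx_erfcxTime _).zero]
    · have h2 : 0 < √2 := by positivity
      rw [if_pos hpos, psiEl_of_ne hne' hpos, ← sub_div, div_div_div_cancel_right₀ h2.ne']
      ring
  of_eq heq t ht := by
    have h2 : 0 < √2 := by positivity
    have heq' : α = lam := by simpa [h2.ne'] using heq
    subst heq'
    rcases (ge_iff_le.1 ht).eq_or_lt with rfl | hpos
    · simp
    · have hs2 : √2 ^ 2 = 2 := Real.sq_sqrt (by norm_num)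
      have hp : 0 < √π := Real.sqrt_pos.2 pi_pos
      rw [if_pos hpos, psiEl_self α hpos, Real.sqrt_mul (by norm_num), div_pow, hs2]
      field_simp
      ring

theorem elastic_crossing_fractional_ode (α lam : ℝ) (hα : 0 < α) (hlam : 0 < lam) :
    (∀ t > (0:ℝ),
      deriv (psiEl α lam) t + ((α + lam) / Real.sqrt 2) * caputo (1/2) (psiEl α lam) t =
        (α * lam / 2) * (1 - psiEl α lam t) - lam / Real.sqrt (2 * Real.pi * t)) ∧
    Filter.Tendsto (psiEl α lam) (nhdsWithin 0 (Set.Ioi 0)) (nhds 1) := by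
  set g : ℝ → ℝ := fun t => if 0 < t then psiEl α lam t - 1 else 0 with hg
  have hcr : IsCrossing (α / √2) (lam / √2) (erfcxTime lam) (erfcxTime α) g :=
    isCrossing_psiEl α lam
  have hF := isErfcx_erfcxTime lam
  have hG := isErfcx_erfcxTime α
  have hpsi : ∀ t > 0, psiEl α lam t = g t + 1 := fun t ht => by
    simp [hg, if_pos (gt_iff_lt.1 ht)]
  have hderiv : ∀ t > 0, deriv (psiEl α lam) t = deriv g t := fun t ht => by
    rw [Filter.EventuallyEq.deriv_eq (Filter.eventuallyEq_of_mem (Ioi_mem_nhds ht) hpsi),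
      deriv_add_const]
  refine ⟨fun t ht => ?_, ?_⟩
  · have hcap : caputo (1 / 2) (psiEl α lam) t = caputo (1 / 2) g t := by
      unfold caputo
      congr 1
      refine intervalIntegral.integral_congr_ae (ae_of_all _ fun s hs => ?_)
      rw [uIoc_of_le (le_of_lt ht)] at hs
      rw [hderiv s hs.1]
    have h := hcr.fractional_ode hF hG (by positivity) (by positivity) ht
    have hs2 : √2 ^ 2 = 2 := Real.sq_sqrt (by norm_num)
    have hab : α / √2 * (lam / √2) = α * lam / 2 := by
      rw [div_mul_div_comm, ← pow_two, hs2]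
    rw [hderiv t ht, hcap, hpsi t ht, add_div, h, hab, Real.sqrt_mul (by positivity),
      Real.sqrt_mul (by norm_num)]
    have hts := Real.sqrt_pos.2 ht
    have hp : 0 < √π := Real.sqrt_pos.2 pi_pos
    field_simp
    ring
  · have h := (hcr.continuousOn hF hG 0 self_mem_Ici).tendsto.mono_left
      (nhdsWithin_mono 0 Ioi_subset_Ici_self)
    rw [hcr.zero hF hG] at h
    have h1 := h.add_const 1
    rw [zero_add] at h1
    exact h1.congr' (Filter.eventuallyEq_of_mem self_mem_nhdsWithin fun t ht => (hpsi t ht).symm)
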